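/- Fix γ ≥ 1. Let (a_j)_{j≥0} be real numbers such that the odd power series f(x) := ∑_{j=0}^{∞} a_j x^{2j+1} converges absolutely for |x| < γ, and suppose the coefficient sequence satisfies one of: (a) a_j ≥ 0 for all j; (b) a_j ≤ 0 for all j; or (c) there exists j₀ ∈ ℕ with a_j ≥ 0 for j ≤ j₀ and a_j ≤ 0 for j > j₀. Then there exist real numbers (F_k)_{k≥0} satisfying one of the same three conditions (a), (b), (c) such that for every x ∈ (−1,1) the series (T₁ f)(x) = ∑_{j∈ℤ, j≠0} (x+2j)^{−2}·f(−1/(x+2j)) converges absolutely and (T₁ f)(x) = ∑_{k=0}^{∞} F_k·x^{2k+1}, the latter power series converging for |x| < 2 − 1/γ. -/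

import Mathlib

open Set

/-- The subtransfer operator `T_β f(x) = ∑_{j∈ℤ, j≠0} (β/(x+2j)²) f(-β/(x+2j))`. -/
noncomputable def Tsub (β : ℝ) (f : ℝ → ℝ) (x : ℝ) : ℝ :=
  ∑' j : {j : ℤ // j ≠ 0},
    (β / (x + 2 * ((j : ℤ) : ℝ)) ^ 2) * f (-β / (x + 2 * ((j : ℤ) : ℝ)))

/-- The coefficient sequence condition: nonnegative, or nonpositive, or changing sign
(from `≥ 0` to `≤ 0`) exactly once. -/
def SignDown (a : ℕ → ℝ) : Prop :=
  (∀ j, 0 ≤ a j) ∨ (∀ j, a j ≤ 0) ∨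
    (∃ j₀ : ℕ, (∀ j ≤ j₀, 0 ≤ a j) ∧ ∀ j, j₀ < j → a j ≤ 0)

/-- The even zeta-type sums `∑_{j≥1} (2j)^{-(2s+4)}`. -/
noncomputable def evenZeta (s : ℕ) : ℝ :=
  ∑' j : ℕ, 1 / (2 * ((j : ℝ) + 1)) ^ (2 * s + 4)

/-- The matrix by which `T₁` acts on the coefficients of odd power series. -/
noncomputable def transferKernel (m k : ℕ) : ℝ :=
  2 * ((2 * k + 1 + (2 * m + 2)).choose (2 * m + 2) : ℝ) * evenZeta (m + k)

lemma summable_evenZeta (s : ℕ) :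
    Summable fun j : ℕ => 1 / (2 * ((j : ℝ) + 1)) ^ (2 * s + 4) := by
  have h := ((Real.summable_one_div_nat_add_rpow 1 ((2 * s + 4 : ℕ) : ℝ)).2
    (by push_cast; linarith [Nat.cast_nonneg (α := ℝ) s])).mul_left ((1 / 2) ^ (2 * s + 4))
  refine h.congr fun j => ?_
  rw [Real.rpow_natCast, abs_of_pos (by positivity), mul_pow, div_pow, one_pow]
  field_simp

lemma evenZeta_pos (s : ℕ) : 0 < evenZeta s :=
  (summable_evenZeta s).tsum_pos (fun j => by positivity) 0 (by positivity)

lemma evenZeta_logConvex (s : ℕ) :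
    evenZeta (s + 1) * evenZeta (s + 1) ≤ evenZeta s * evenZeta (s + 2) := by
  have hpos := evenZeta_pos s
  set t := evenZeta (s + 1) / evenZeta s with ht
  have h0 : 0 ≤ t ^ 2 * evenZeta s - 2 * t * evenZeta (s + 1) + evenZeta (s + 2) := by
    have h : HasSum (fun j : ℕ => t ^ 2 * (1 / (2 * ((j : ℝ) + 1)) ^ (2 * s + 4))
        - 2 * t * (1 / (2 * ((j : ℝ) + 1)) ^ (2 * (s + 1) + 4))
        + 1 / (2 * ((j : ℝ) + 1)) ^ (2 * (s + 2) + 4))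
        (t ^ 2 * evenZeta s - 2 * t * evenZeta (s + 1) + evenZeta (s + 2)) :=
      (((summable_evenZeta s).hasSum.mul_left _).sub
        ((summable_evenZeta (s + 1)).hasSum.mul_left _)).add (summable_evenZeta (s + 2)).hasSum
    refine h.nonneg fun j => ?_
    have hb : 0 < 2 * ((j : ℝ) + 1) := by positivity
    generalize 2 * ((j : ℝ) + 1) = b at hb
    have : t ^ 2 * (1 / b ^ (2 * s + 4)) - 2 * t * (1 / b ^ (2 * (s + 1) + 4))
        + 1 / b ^ (2 * (s + 2) + 4) = (t - 1 / b ^ 2) ^ 2 * (1 / b ^ (2 * s + 4)) := by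
      field_simp
      ring
    rw [this]
    positivity
  have h1 : t * evenZeta s = evenZeta (s + 1) := by rw [ht]; field_simp
  have h2 : evenZeta s * (t ^ 2 * evenZeta s - 2 * t * evenZeta (s + 1) + evenZeta (s + 2))
      = evenZeta s * evenZeta (s + 2) - evenZeta (s + 1) * evenZeta (s + 1) := by
    rw [← h1]; ring
  have := mul_nonneg hpos.le h0
  linarith

lemma factorial_mul_evenZeta_logConvex (s : ℕ) :
    ((2 * (s + 1) + 3).factorial * evenZeta (s + 1)) *
        ((2 * (s + 1) + 3).factorial * evenZeta (s + 1)) ≤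
      ((2 * s + 3).factorial * evenZeta s) * ((2 * (s + 2) + 3).factorial * evenZeta (s + 2)) := by
  have h1 : ((2 * (s + 1) + 3).factorial : ℝ) =
      (2 * s + 5) * (2 * s + 4) * (2 * s + 3).factorial := by
    rw [show 2 * (s + 1) + 3 = 2 * s + 3 + 1 + 1 by ring, Nat.factorial_succ, Nat.factorial_succ]
    push_cast; ring
  have h2 : ((2 * (s + 2) + 3).factorial : ℝ) =
      (2 * s + 7) * (2 * s + 6) * ((2 * s + 5) * (2 * s + 4) * (2 * s + 3).factorial) := by
    rw [← h1, show 2 * (s + 2) + 3 = 2 * (s + 1) + 3 + 1 + 1 by ring, Nat.factorial_succ,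
      Nat.factorial_succ]
    push_cast; ring
  have hs : (0 : ℝ) ≤ s := s.cast_nonneg
  have h3 : ((2 * (s + 1) + 3).factorial : ℝ) * (2 * (s + 1) + 3).factorial ≤
      (2 * s + 3).factorial * (2 * (s + 2) + 3).factorial := by
    rw [h1, h2]
    have hf : (0 : ℝ) < (2 * s + 3).factorial := by positivity
    generalize ((2 * s + 3).factorial : ℝ) = c at hf
    have : 0 ≤ c * c * ((2 * s + 5) * (2 * s + 4)) *
        ((2 * s + 7) * (2 * s + 6) - (2 * s + 5) * (2 * s + 4) : ℝ) := by
      have : (0 : ℝ) ≤ (2 * s + 7) * (2 * s + 6) - (2 * s + 5) * (2 * s + 4) := by nlinarith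
      positivity
    nlinarith
  have h4 := mul_le_mul h3 (evenZeta_logConvex s)
    (mul_nonneg (evenZeta_pos _).le (evenZeta_pos _).le) (by positivity)
  nlinarith

lemma mul_le_mul_of_logConvex {A : ℕ → ℝ} (hpos : ∀ s, 0 < A s)
    (hA : ∀ s, A (s + 1) * A (s + 1) ≤ A s * A (s + 2)) (p d : ℕ) :
    A (p + d) * A (p + 1) ≤ A p * A (p + d + 1) := by
  induction d with
  | zero => exact le_of_eq (by ring_nf)
  | succ d ih =>
    have h1 := hA (p + d)
    have h2 := hpos (p + d)
    rw [← add_assoc]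
    refine le_of_mul_le_mul_left ?_ h2
    calc A (p + d) * (A (p + d + 1) * A (p + 1))
        = A (p + d + 1) * (A (p + d) * A (p + 1)) := by ring
      _ ≤ A (p + d + 1) * (A p * A (p + d + 1)) := mul_le_mul_of_nonneg_left ih (hpos _).le
      _ = A p * (A (p + d + 1) * A (p + d + 1)) := by ring
      _ ≤ A p * (A (p + d) * A (p + d + 2)) := mul_le_mul_of_nonneg_left h1 (hpos _).le
      _ = A (p + d) * (A p * A (p + d + 1 + 1)) := by ring

lemma transferKernel_pos (m k : ℕ) : 0 < transferKernel m k := by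
  have := evenZeta_pos (m + k)
  have : 0 < (2 * k + 1 + (2 * m + 2)).choose (2 * m + 2) := Nat.choose_pos (by omega)
  unfold transferKernel
  positivity

lemma transferKernel_eq (m k : ℕ) :
    transferKernel m k = 2 / ((2 * k + 1).factorial * (2 * m + 2).factorial) *
      ((2 * (m + k) + 3).factorial * evenZeta (m + k)) := by
  have h := Nat.add_choose_mul_factorial_mul_factorial (2 * k + 1) (2 * m + 2)
  have h' : ((2 * (m + k) + 3).factorial : ℝ) =
      ((2 * k + 1 + (2 * m + 2)).choose (2 * m + 2) : ℝ) * (2 * k + 1).factorial *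
        (2 * m + 2).factorial := by
    rw [show 2 * (m + k) + 3 = 2 * k + 1 + (2 * m + 2) by ring, ← h]
    push_cast; ring
  rw [transferKernel, h']
  field_simp

lemma transferKernel_mul_le {m m' : ℕ} (hm : m ≤ m') (k : ℕ) :
    transferKernel m (k + 1) * transferKernel m' k ≤
      transferKernel m k * transferKernel m' (k + 1) := by
  obtain ⟨d, rfl⟩ := Nat.exists_eq_add_of_le hm
  have h := mul_le_mul_of_logConvex (A := fun s => (2 * s + 3).factorial * evenZeta s)
    (fun s => mul_pos (by positivity) (evenZeta_pos s)) factorial_mul_evenZeta_logConvex (m + k) d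
  simp only [transferKernel_eq]
  simp only [show m + d + k = m + k + d by ring, show m + (k + 1) = m + k + 1 by ring,
    show m + d + (k + 1) = m + k + d + 1 by ring]
  have hc : (0 : ℝ) ≤ 2 / ((2 * k + 1).factorial * (2 * m + 2).factorial) *
      (2 / ((2 * (k + 1) + 1).factorial * (2 * (m + d) + 2).factorial)) := by positivity
  refine le_trans (le_of_eq ?_) ((mul_le_mul_of_nonneg_left h hc).trans (le_of_eq ?_))
  · field_simp
  · ring

lemma SignDown.of_neg_succ {F : ℕ → ℝ} (h : ∀ k, F k < 0 → F (k + 1) < 0) : SignDown F := by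
  classical
  by_cases hF : ∀ k, 0 ≤ F k
  · exact Or.inl hF
  push Not at hF
  have hneg : ∀ j, Nat.find hF ≤ j → F j < 0 := fun j hj =>
    Nat.le_induction (Nat.find_spec hF) (fun k _ hk => h k hk) j hj
  rcases Nat.eq_zero_or_pos (Nat.find hF) with h0 | h0
  · exact Or.inr (Or.inl fun j => (hneg j (by omega)).le)
  · refine Or.inr (Or.inr ⟨Nat.find hF - 1, fun j hj => ?_, fun j hj => (hneg j (by omega)).le⟩)
    exact not_lt.1 (Nat.find_min hF (show j < Nat.find hF by omega))

lemma SignDown.transfer {a : ℕ → ℝ} (ha : SignDown a)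
    (hs : ∀ k, Summable fun m => a m * transferKernel m k) :
    SignDown fun k => ∑' m, a m * transferKernel m k := by
  rcases ha with ha | ha | ⟨j₀, ha, hb⟩
  · exact Or.inl fun k => tsum_nonneg fun m => mul_nonneg (ha m) (transferKernel_pos m k).le
  · exact Or.inr (Or.inl fun k => tsum_nonpos fun m =>
      mul_nonpos_of_nonpos_of_nonneg (ha m) (transferKernel_pos m k).le)
  · refine SignDown.of_neg_succ fun k hk => ?_
    have key : (∑' m, a m * transferKernel m (k + 1)) * transferKernel j₀ k ≤
        (∑' m, a m * transferKernel m k) * transferKernel j₀ (k + 1) := by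
      rw [← tsum_mul_right, ← tsum_mul_right]
      refine Summable.tsum_le_tsum (fun m => ?_) ((hs (k + 1)).mul_right _) ((hs k).mul_right _)
      rw [mul_assoc, mul_assoc]
      rcases le_or_gt m j₀ with hm | hm
      · exact mul_le_mul_of_nonneg_left (transferKernel_mul_le hm k) (ha m hm)
      · refine mul_le_mul_of_nonpos_left ?_ (hb m hm)
        have := transferKernel_mul_le hm.le k
        linarith
    have h1 := mul_neg_of_neg_of_pos hk (transferKernel_pos j₀ (k + 1))
    exact neg_of_mul_neg_left (key.trans_lt h1) (transferKernel_pos j₀ k).le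

lemma hasSum_odd_choose_mul {b x : ℝ} (hx : |x| < b) (m : ℕ) :
    HasSum (fun k : ℕ => 2 * ((2 * k + 1 + (2 * m + 2)).choose (2 * m + 2) : ℝ) * x ^ (2 * k + 1) /
      b ^ (2 * (m + k) + 4)) (1 / (b - x) ^ (2 * m + 3) - 1 / (b + x) ^ (2 * m + 3)) := by
  have hb : 0 < b := (abs_nonneg x).trans_lt hx
  obtain ⟨hx1, hx2⟩ := abs_lt.1 hx
  have hr : ‖x / b‖ < 1 := by
    rwa [norm_div, Real.norm_eq_abs, Real.norm_eq_abs, abs_of_pos hb, div_lt_one hb]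
  have hr' : ‖-(x / b)‖ < 1 := by rwa [norm_neg]
  have h := ((hasSum_choose_mul_geometric_of_norm_lt_one (2 * m + 2) hr).sub
    (hasSum_choose_mul_geometric_of_norm_lt_one (2 * m + 2) hr')).mul_left (1 / b ^ (2 * m + 3))
  have hinj : Function.Injective fun k : ℕ => 2 * k + 1 := fun i j hij => by
    simp only at hij; omega
  rw [← hinj.hasSum_iff] at h
  · convert! h using 1
    · funext k
      have hodd : Odd (2 * k + 1) := ⟨k, rfl⟩
      simp only [Function.comp_apply, hodd.neg_pow, div_pow]
      field_simp
      ring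
    · have e1 : 1 - x / b = (b - x) / b := by field_simp
      have e2 : 1 - -(x / b) = (b + x) / b := by field_simp; ring
      have p1 : 0 < b - x := by linarith
      have p2 : 0 < b + x := by linarith
      rw [e1, e2, div_pow, div_pow]
      field_simp
  · intro i hi
    have hev : Even i := by
      by_contra hne
      obtain ⟨k, hk⟩ := Nat.not_even_iff_odd.1 hne
      exact hi ⟨k, hk.symm⟩
    rw [hev.neg_pow]
    ring

/-- The terms of the expansion of `T₁ f(x)`, with index `((j, m), k)`. -/
noncomputable def transferTerm (a : ℕ → ℝ) (x : ℝ) (p : (ℕ × ℕ) × ℕ) : ℝ :=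
  a p.1.2 * (2 * ((2 * p.2 + 1 + (2 * p.1.2 + 2)).choose (2 * p.1.2 + 2) : ℝ) *
    x ^ (2 * p.2 + 1) / (2 * ((p.1.1 : ℝ) + 1)) ^ (2 * (p.1.2 + p.2) + 4))

lemma abs_lt_two_mul_succ {x : ℝ} (hx : |x| < 2) (j : ℕ) : |x| < 2 * ((j : ℝ) + 1) := by
  have : (0 : ℝ) ≤ j := j.cast_nonneg
  linarith

lemma hasSum_transferTerm (a : ℕ → ℝ) {x : ℝ} (hx : |x| < 2) (q : ℕ × ℕ) :
    HasSum (fun k => transferTerm a x (q, k))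
      (a q.2 * (1 / (2 * ((q.1 : ℝ) + 1) - x) ^ (2 * q.2 + 3) -
        1 / (2 * ((q.1 : ℝ) + 1) + x) ^ (2 * q.2 + 3))) :=
  (hasSum_odd_choose_mul (abs_lt_two_mul_succ hx q.1) q.2).mul_left _

lemma norm_transferTerm (a : ℕ → ℝ) (x : ℝ) (p : (ℕ × ℕ) × ℕ) :
    ‖transferTerm a x p‖ = transferTerm (fun m => |a m|) |x| p := by
  rw [transferTerm, transferTerm, norm_mul, norm_div, norm_mul, norm_mul, norm_pow, norm_pow]
  simp only [Real.norm_eq_abs, Nat.abs_cast, Nat.abs_ofNat]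
  rw [abs_of_nonneg (by positivity : (0 : ℝ) ≤ 2 * ((p.1.1 : ℝ) + 1))]

lemma summable_one_div_sq_add {d : ℝ} (hd : 0 < d) :
    Summable fun j : ℕ => 1 / (2 * (j : ℝ) + d) ^ 2 := by
  refine (((Real.summable_one_div_nat_add_rpow (d / 2) ((2 : ℕ) : ℝ)).2
    (by norm_num)).mul_left (1 / 4)).congr fun j => ?_
  rw [Real.rpow_natCast, abs_of_pos (by positivity)]
  field_simp
  ring

lemma summable_transferTerm {a : ℕ → ℝ} {x : ℝ} (hx : |x| < 2)
    (ha : Summable fun m => |a m| * (1 / (2 - |x|)) ^ (2 * m + 1)) :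
    Summable (transferTerm a x) := by
  have hd : 0 < 2 - |x| := by linarith
  have hx' : |(|x|)| < 2 := by rwa [abs_abs]
  refine Summable.of_norm ?_
  simp only [norm_transferTerm]
  rw [summable_prod_of_nonneg fun p => by rw [← norm_transferTerm]; exact norm_nonneg _]
  refine ⟨fun q => (hasSum_transferTerm _ hx' q).summable, ?_⟩
  simp only [(hasSum_transferTerm (fun m => |a m|) hx' _).tsum_eq]
  refine Summable.of_nonneg_of_le (fun q => ?_) (fun q => ?_)
    ((summable_one_div_sq_add hd).mul_of_nonneg ha (fun j => by positivity)
      (fun m => by positivity))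
  · rw [← (hasSum_transferTerm (fun m => |a m|) hx' q).tsum_eq]
    exact tsum_nonneg fun k => by rw [← norm_transferTerm]; exact norm_nonneg _
  · obtain ⟨j, m⟩ := q
    have hj : (0 : ℝ) ≤ j := j.cast_nonneg
    have h0 := abs_nonneg x
    have e : 2 * ((j : ℝ) + 1) - |x| = 2 * j + (2 - |x|) := by ring
    simp only
    rw [e]
    have h1 : 1 / (2 * (j : ℝ) + (2 - |x|)) ^ (2 * m + 1) ≤ (1 / (2 - |x|)) ^ (2 * m + 1) := by
      rw [one_div_pow]
      exact one_div_le_one_div_of_le (by positivity) (pow_le_pow_left₀ hd.le (by linarith) _)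
    calc |a m| * (1 / (2 * (j : ℝ) + (2 - |x|)) ^ (2 * m + 3) -
          1 / (2 * ((j : ℝ) + 1) + |x|) ^ (2 * m + 3))
        ≤ |a m| * (1 / (2 * (j : ℝ) + (2 - |x|)) ^ (2 * m + 3)) := by
          refine mul_le_mul_of_nonneg_left (sub_le_self _ (by positivity)) (abs_nonneg _)
      _ = 1 / (2 * (j : ℝ) + (2 - |x|)) ^ 2 *
          (|a m| * (1 / (2 * (j : ℝ) + (2 - |x|)) ^ (2 * m + 1))) := by
          field_simp
          ring
      _ ≤ _ := by gcongr

lemma hasSum_mul_transferKernel {a : ℕ → ℝ} {x : ℝ} (h : Summable (transferTerm a x)) (k : ℕ) :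
    HasSum (fun m => a m * transferKernel m k * x ^ (2 * k + 1))
      (∑' q : ℕ × ℕ, transferTerm a x (q, k)) := by
  have hk : Summable fun q : ℕ × ℕ => transferTerm a x (q, k) := h.prod_symm.prod_factor k
  have hsw := hk.prod_symm
  have e : ∀ m, ∑' j, transferTerm a x ((j, m), k) =
      a m * transferKernel m k * x ^ (2 * k + 1) := fun m => by
    simp only [transferTerm, transferKernel, evenZeta]
    rw [← tsum_mul_left, ← tsum_mul_left, ← tsum_mul_right]
    refine tsum_congr fun j => ?_
    ring
  have h1 : ∑' q : ℕ × ℕ, transferTerm a x (q, k) =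
      ∑' q : ℕ × ℕ, transferTerm a x (q.swap, k) :=
    ((Equiv.prodComm ℕ ℕ).tsum_eq fun q => transferTerm a x (q, k)).symm
  rw [h1, hsw.tsum_prod]
  simp only [← e]
  exact hsw.prod.hasSum

lemma summable_mul_transferKernel {a : ℕ → ℝ} {x : ℝ} (hx : x ≠ 0)
    (h : Summable (transferTerm a x)) (k : ℕ) : Summable fun m => a m * transferKernel m k :=
  (summable_mul_right_iff (pow_ne_zero _ hx)).1 (hasSum_mul_transferKernel h k).summable

lemma hasSum_transfer {a : ℕ → ℝ} {x : ℝ} (hx : |x| < 2) (h : Summable (transferTerm a x)) :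
    HasSum (fun k => (∑' m, a m * transferKernel m k) * x ^ (2 * k + 1))
      (∑' j : ℕ, ∑' m : ℕ, a m * (1 / (2 * ((j : ℝ) + 1) - x) ^ (2 * m + 3) -
        1 / (2 * ((j : ℝ) + 1) + x) ^ (2 * m + 3))) := by
  have e : ∀ k, ∑' q : ℕ × ℕ, transferTerm a x (q, k) =
      (∑' m, a m * transferKernel m k) * x ^ (2 * k + 1) := fun k => by
    rw [← (hasSum_mul_transferKernel h k).tsum_eq, tsum_mul_right]
  have h1 : Summable fun k => ∑' q : ℕ × ℕ, transferTerm a x (q, k) := h.prod_symm.prod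
  have h2 : ∑' k, ∑' q : ℕ × ℕ, transferTerm a x (q, k) =
      ∑' q : ℕ × ℕ, ∑' k, transferTerm a x (q, k) :=
    Summable.tsum_comm (f := fun q k => transferTerm a x (q, k)) h
  have h3 := h.prod.tsum_prod
  simp only [(hasSum_transferTerm a hx _).tsum_eq] at h2 h3
  rw [← h3, ← h2]
  simpa only [e] using h1.hasSum

lemma summable_abs_transfer_summand {a : ℕ → ℝ} {f : ℝ → ℝ}
    (hf : ∀ x : ℝ, f x = ∑' j : ℕ, a j * x ^ (2 * j + 1)) {x : ℝ} (hx : |x| < 2)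
    (ha : Summable fun m => |a m| * (1 / (2 - |x|)) ^ (2 * m + 1)) :
    Summable (fun j : {j : ℤ // j ≠ 0} =>
      |(1 / (x + 2 * ((j : ℤ) : ℝ)) ^ 2) * f (-1 / (x + 2 * ((j : ℤ) : ℝ)))|) := by
  have hd : 0 < 2 - |x| := by linarith
  have hs : Summable fun j : ℤ => 1 / (x + 2 * (j : ℝ)) ^ 2 := by
    refine (((Real.summable_one_div_int_add_rpow (x / 2) ((2 : ℕ) : ℝ)).2
      (by norm_num)).mul_left (1 / 4)).congr fun j => ?_
    rw [Real.rpow_natCast, sq_abs, one_div_mul_one_div]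
    congr 1
    ring
  refine Summable.of_nonneg_of_le (fun _ => abs_nonneg _) (fun j => ?_)
    ((hs.mul_right (∑' m, |a m| * (1 / (2 - |x|)) ^ (2 * m + 1))).comp_injective
      (Subtype.val_injective (p := fun j : ℤ => j ≠ 0)))
  obtain ⟨j, hj⟩ := j
  simp only [Function.comp_apply]
  have hge : 2 - |x| ≤ |x + 2 * (j : ℝ)| := by
    have h1 : (1 : ℝ) ≤ |(j : ℝ)| := by exact_mod_cast Int.one_le_abs hj
    have h2 : |2 * (j : ℝ)| ≤ |x + 2 * (j : ℝ)| + |x| := by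
      calc |2 * (j : ℝ)| = |x + 2 * (j : ℝ) - x| := by ring_nf
        _ ≤ _ := abs_sub _ _
    rw [abs_mul, abs_two] at h2
    linarith
  rw [abs_mul, abs_of_nonneg (by positivity : 0 ≤ 1 / (x + 2 * (j : ℝ)) ^ 2)]
  refine mul_le_mul_of_nonneg_left ?_ (by positivity)
  rw [hf, ← Real.norm_eq_abs]
  refine tsum_of_norm_bounded ha.hasSum fun m => ?_
  rw [norm_mul, norm_pow, norm_div, norm_neg, norm_one]
  simp only [Real.norm_eq_abs]
  gcongr

lemma transfer_eq_tsum_nat {a : ℕ → ℝ} {f : ℝ → ℝ}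
    (hf : ∀ x : ℝ, f x = ∑' j : ℕ, a j * x ^ (2 * j + 1)) {x : ℝ} (hx : |x| < 2)
    (ha : Summable fun m => |a m| * (1 / (2 - |x|)) ^ (2 * m + 1)) :
    Tsub 1 f x = ∑' j : ℕ, ∑' m : ℕ, a m * (1 / (2 * ((j : ℝ) + 1) - x) ^ (2 * m + 3) -
        1 / (2 * ((j : ℝ) + 1) + x) ^ (2 * m + 3)) := by
  have hd : 0 < 2 - |x| := by linarith
  set t : ℤ → ℝ := fun j => 1 / (x + 2 * (j : ℝ)) ^ 2 * f (-1 / (x + 2 * (j : ℝ))) with ht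
  have hsub : Summable (t ∘ ((↑) : {j : ℤ | j ≠ 0} → ℤ)) :=
    (summable_abs_transfer_summand hf hx ha).of_abs
  have hT : Tsub 1 f x = ∑' j : ℤ, {j : ℤ | j ≠ 0}.indicator t j :=
    tsum_subtype {j : ℤ | j ≠ 0} t
  rw [summable_subtype_iff_indicator] at hsub
  have i1 : Function.Injective fun n : ℕ => (n : ℤ) + 1 := fun i j h => by
    simp only at h; omega
  have i2 : Function.Injective fun n : ℕ => -((n : ℤ) + 1) := fun i j h => by
    simp only at h; omega
  have s1 : Summable fun n : ℕ => {j : ℤ | j ≠ 0}.indicator t ((n : ℤ) + 1) :=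
    hsub.comp_injective i1
  have s2 : Summable fun n : ℕ => {j : ℤ | j ≠ 0}.indicator t (-((n : ℤ) + 1)) :=
    hsub.comp_injective i2
  rw [hT, tsum_of_add_one_of_neg_add_one s1 s2, Set.indicator_of_notMem (by simp), add_zero,
    ← Summable.tsum_add s1 s2]
  refine tsum_congr fun n => ?_
  rw [Set.indicator_of_mem (show (n : ℤ) + 1 ≠ 0 by omega),
    Set.indicator_of_mem (show -((n : ℤ) + 1) ≠ 0 by omega), ht]
  have hn : (0 : ℝ) ≤ n := n.cast_nonneg
  obtain ⟨hx1, hx2⟩ := abs_lt.1 (abs_lt_two_mul_succ hx n)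
  have hb1 : 2 - |x| ≤ 2 * ((n : ℝ) + 1) - x := by linarith [le_abs_self x]
  have hb2 : 2 - |x| ≤ 2 * ((n : ℝ) + 1) + x := by linarith [neg_abs_le x]
  have hser : ∀ c : ℝ, 2 - |x| ≤ c →
      Summable fun m => a m * (1 / c ^ (2 * m + 3)) := fun c hc => by
    have hc0 : 0 < c := hd.trans_le hc
    refine Summable.of_norm_bounded (ha.mul_left (1 / c ^ 2)) fun m => ?_
    rw [norm_mul, Real.norm_eq_abs, Real.norm_of_nonneg (by positivity)]
    have : 1 / c ^ (2 * m + 3) = 1 / c ^ 2 * (1 / c) ^ (2 * m + 1) := by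
      rw [one_div_pow]; field_simp; ring
    rw [this, mul_left_comm]
    gcongr
  simp only [mul_sub]
  rw [Summable.tsum_sub (hser _ hb1) (hser _ hb2), hf, hf, ← tsum_mul_left, ← tsum_mul_left,
    add_comm, sub_eq_add_neg, ← tsum_neg]
  push_cast
  have e1 : x + 2 * (-((n : ℝ) + 1)) = -(2 * ((n : ℝ) + 1) - x) := by ring
  have e2 : x + 2 * ((n : ℝ) + 1) = 2 * ((n : ℝ) + 1) + x := by ring
  rw [e1, e2]
  have c1 : 2 * ((n : ℝ) + 1) - x ≠ 0 := by linarith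
  have c2 : 2 * ((n : ℝ) + 1) + x ≠ 0 := by linarith
  generalize 2 * ((n : ℝ) + 1) - x = b at c1
  generalize 2 * ((n : ℝ) + 1) + x = c at c2
  congr 1 <;> refine tsum_congr fun m => ?_
  · rw [neg_div_neg_eq, neg_sq, one_div_pow]
    field_simp
    ring
  · rw [neg_div, Odd.neg_pow ⟨m, rfl⟩, one_div_pow]
    field_simp
    ring

/-- `T₁` preserves the class of odd power series with single-sign-change coefficient
sequences: if `f(x) = ∑ a_j x^{2j+1}` converges absolutely for `|x| < γ` (where `γ ≥ 1`)
with coefficients satisfying the sign condition, then `T₁ f(x) = ∑ F_k x^{2k+1}` for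
coefficients `F_k` satisfying the same condition, the power series converging for
`|x| < 2 - 1/γ`, and the series defining `T₁ f(x)` converging absolutely on `(-1,1)`. -/
theorem transfer_preserves_signDown_class
    (γ : ℝ) (hγ : 1 ≤ γ) (a : ℕ → ℝ)
    (hconv : ∀ x : ℝ, |x| < γ → Summable (fun j : ℕ => |a j * x ^ (2 * j + 1)|))
    (hsign : SignDown a)
    (f : ℝ → ℝ) (hf : ∀ x : ℝ, f x = ∑' j : ℕ, a j * x ^ (2 * j + 1)) :
    ∃ F : ℕ → ℝ, SignDown F ∧
      (∀ x : ℝ, |x| < 2 - 1 / γ → Summable (fun k : ℕ => F k * x ^ (2 * k + 1))) ∧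
      (∀ x ∈ Ioo (-1 : ℝ) 1,
        Summable (fun j : {j : ℤ // j ≠ 0} =>
          |(1 / (x + 2 * ((j : ℤ) : ℝ)) ^ 2) * f (-1 / (x + 2 * ((j : ℤ) : ℝ)))|) ∧
        Tsub 1 f x = ∑' k : ℕ, F k * x ^ (2 * k + 1)) := by
  have hγ0 : 0 < γ := by linarith
  have hγ1 : 1 / γ ≤ 1 := by rw [div_le_one hγ0]; exact hγ
  have hγ2 : 0 < 1 / γ := by positivity
  have ha : ∀ x : ℝ, |x| < 2 - 1 / γ →
      Summable fun m => |a m| * (1 / (2 - |x|)) ^ (2 * m + 1) := fun x hx => by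
    have hd : 0 < 2 - |x| := by linarith
    have hy : |1 / (2 - |x|)| < γ := by
      rw [abs_of_pos (by positivity), one_div_lt hd hγ0]
      linarith
    refine (hconv _ hy).congr fun m => ?_
    rw [abs_mul, abs_of_nonneg (a := (1 / (2 - |x|)) ^ (2 * m + 1)) (by positivity)]
  have hT : ∀ x : ℝ, |x| < 2 - 1 / γ → Summable (transferTerm a x) := fun x hx =>
    summable_transferTerm (by linarith) (ha x hx)
  have hhalf : |(1 / 2 : ℝ)| < 2 - 1 / γ := by
    rw [abs_of_pos (by norm_num)]; linarith
  refine ⟨fun k => ∑' m, a m * transferKernel m k,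
    hsign.transfer (summable_mul_transferKernel (by norm_num) (hT _ hhalf)),
    fun x hx => (hasSum_transfer (by linarith) (hT x hx)).summable, fun x hx => ?_⟩
  have hx1 : |x| < 1 := abs_lt.2 hx
  have hxγ : |x| < 2 - 1 / γ := by linarith
  have hx2 : |x| < 2 := by linarith
  exact ⟨summable_abs_transfer_summand hf hx2 (ha x hxγ),
    (transfer_eq_tsum_nat hf hx2 (ha x hxγ)).trans (hasSum_transfer hx2 (hT x hxγ)).tsum_eq.symm⟩
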